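/- Let X be a standard Borel space and E a countable Borel equivalence relation on X. Then there exists an action of the free group on countably many generators (FreeGroup ℕ) on X such that for each group element γ the map x ↦ γ • x is Borel, and for all x, y ∈ X: E x y if and only if there exists γ with γ • x = y. (Feldman–Moore theorem, original form: every CBER is the orbit equivalence relation of a Borel action of a countable group, which may be taken to be free.) -/

import Mathlib

open Set Filter Topology MeasureTheory TopologicalSpace

section SeparationOfAnalyticSets

variable {α : Type*} [TopologicalSpace α]

theorem MeasureTheory.AnalyticSet.inter_of_t2 [T2Space α] {s t : Set α}
    (hs : AnalyticSet s) (ht : AnalyticSet t) : AnalyticSet (s ∩ t) := by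
  rw [inter_eq_iInter]
  exact AnalyticSet.iInter fun b => by cases b <;> assumption

/-- Lusin separation for finitely many analytic sets whose intersection is disjoint from a given
analytic set. -/
theorem MeasureTheory.AnalyticSet.exists_measurableSet_superset_disjoint_biInter
    [PolishSpace α] [MeasurableSpace α] [BorelSpace α] {ι : Type*} (S : Finset ι)
    {A : ι → Set α} (hA : ∀ i, AnalyticSet (A i)) {C : Set α} (hC : AnalyticSet C)
    (h : Disjoint C (⋂ i ∈ S, A i)) :
    ∃ B : ι → Set α, (∀ i, MeasurableSet (B i)) ∧ (∀ i, A i ⊆ B i) ∧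
      Disjoint C (⋂ i ∈ S, B i) := by
  classical
  induction S using Finset.induction_on generalizing C with
  | empty => exact ⟨fun _ => univ, fun _ => .univ, fun _ => subset_univ _, by simpa using h⟩
  | insert i S hi ih =>
    rw [Finset.set_biInter_insert, disjoint_iff_inter_eq_empty, ← inter_assoc,
      ← disjoint_iff_inter_eq_empty] at h
    obtain ⟨B, hBm, hAB, hB⟩ := ih (hC.inter_of_t2 (hA i)) h
    have hBS : AnalyticSet (⋂ j ∈ S, B j) :=
      (S.measurableSet_biInter fun j _ => hBm j).analyticSet
    obtain ⟨D, hAD, hD, hDm⟩ := (hA i).measurablySeparable (hC.inter_of_t2 hBS)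
      (disjoint_left.2 fun x hxA hx => disjoint_left.1 hB ⟨hx.1, hxA⟩ hx.2)
    refine ⟨Function.update B i D, fun j => ?_, fun j => ?_, ?_⟩
    · obtain rfl | hj := eq_or_ne j i <;> simp [*]
    · obtain rfl | hj := eq_or_ne j i <;> simp [*]
    · refine disjoint_left.2 fun x hxC hx => disjoint_left.1 hD ⟨hxC, mem_iInter₂.2 fun j hj => ?_⟩ ?_
      · have hji : j ≠ i := ne_of_mem_of_not_mem hj hi
        simpa [hji] using mem_iInter₂.1 hx j (Finset.mem_insert_of_mem hj)
      · simpa using mem_iInter₂.1 hx i (Finset.mem_insert_self i S)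

end SeparationOfAnalyticSets

section CountableToOne

variable {Z X : Type*} [MeasurableSpace Z]

/-- `A` is covered by countably many measurable sets on each of which `f` is injective. -/
def CountablyInjOn (f : Z → X) (A : Set Z) : Prop :=
  ∃ C : Set (Set Z), C.Countable ∧ (∀ B ∈ C, MeasurableSet B ∧ InjOn f B) ∧ A ⊆ ⋃₀ C

theorem CountablyInjOn.mono {f : Z → X} {A A' : Set Z} (h : CountablyInjOn f A) (hA : A' ⊆ A) :
    CountablyInjOn f A' :=
  let ⟨C, hC, hCB, hAC⟩ := h
  ⟨C, hC, hCB, hA.trans hAC⟩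

theorem CountablyInjOn.iUnion {f : Z → X} {κ : Type*} [Countable κ] {A : κ → Set Z}
    (h : ∀ k, CountablyInjOn f (A k)) : CountablyInjOn f (⋃ k, A k) := by
  choose C hC hCB hAC using h
  refine ⟨⋃ k, C k, countable_iUnion hC, ?_, ?_⟩
  · simp only [mem_iUnion]
    rintro B ⟨k, hk⟩
    exact hCB k B hk
  · rw [sUnion_iUnion]
    exact iUnion_mono hAC

theorem Set.InjOn.countablyInjOn {f : Z → X} {A : Set Z} (h : InjOn f A) (hA : MeasurableSet A) :
    CountablyInjOn f A :=
  ⟨{A}, countable_singleton A, by simpa using ⟨hA, h⟩, by simp⟩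

theorem CountablyInjOn.union {f : Z → X} {A A' : Set Z} (h : CountablyInjOn f A)
    (h' : CountablyInjOn f A') : CountablyInjOn f (A ∪ A') := by
  rw [union_eq_iUnion]
  exact .iUnion fun b => by cases b <;> assumption

variable [MeasurableSpace X]

/-- The base space has a measurable cover `D` such that each `U i` is countably injective over
`D i`. -/
def CountablyInjFamily {ι : Type*} (f : Z → X) (U : ι → Set Z) : Prop :=
  ∃ D : ι → Set X, (∀ i, MeasurableSet (D i)) ∧ (∀ x, ∃ i, x ∈ D i) ∧
    ∀ i, CountablyInjOn f (U i ∩ f ⁻¹' D i)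

theorem CountablyInjFamily.comp_surjective {ι κ : Type*} {f : Z → X} {U : ι → Set Z}
    (h : CountablyInjFamily f U) {e : κ → ι} (he : e.Surjective) :
    CountablyInjFamily f (U ∘ e) := by
  obtain ⟨D, hD, hcov, hinj⟩ := h
  refine ⟨D ∘ e, fun k => hD _, fun x => ?_, fun k => hinj _⟩
  obtain ⟨i, hi⟩ := hcov x
  obtain ⟨k, rfl⟩ := he i
  exact ⟨k, hi⟩

theorem countablyInjFamily_of_eq_empty {ι : Type*} {f : Z → X} {U : ι → Set Z} {i : ι}
    (hi : U i = ∅) : CountablyInjFamily f U := by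
  classical
  refine ⟨fun j => {x | j = i}, fun j => .const _, fun x => ⟨i, rfl⟩, fun j => ?_⟩
  refine ((injOn_empty f).countablyInjOn .empty).mono ?_
  rintro z ⟨hz, rfl : j = i⟩
  rwa [hi] at hz

theorem countablyInjFamily_of_separated {ι : Type*} {f : Z → X} {U : ι → Set Z} {i j : ι}
    (hij : i ≠ j) {O : Set X} (hO : MeasurableSet O) (hi : MapsTo f (U i) O)
    (hj : MapsTo f (U j) Oᶜ) : CountablyInjFamily f U := by
  classical
  refine ⟨fun k => {x | k = i ∧ x ∈ Oᶜ ∨ k = j ∧ x ∈ O}, fun k => ?_, fun x => ?_, fun k => ?_⟩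
  · exact ((MeasurableSet.const _).inter hO.compl).union ((MeasurableSet.const _).inter hO)
  · by_cases hx : x ∈ O
    · exact ⟨j, .inr ⟨rfl, hx⟩⟩
    · exact ⟨i, .inl ⟨rfl, hx⟩⟩
  · refine ((injOn_empty f).countablyInjOn .empty).mono ?_
    rintro z ⟨hz, ⟨rfl, hzO⟩ | ⟨rfl, hzO⟩⟩
    · exact hzO (hi hz)
    · exact hj hz hzO

/-- If all the families obtained by choosing, for each `i`, one of countably many pairs of subsets
separating the points of `U i`, are countably injective, then so is `U`. -/
theorem countablyInjFamily_of_forall_split [StandardBorelSpace Z] [StandardBorelSpace X]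
    {ι κ : Type*} [Finite ι] [Countable κ] {f : Z → X} (hf : Measurable f) {U : ι → Set Z}
    (hU : ∀ i, MeasurableSet (U i)) (V : ι → κ → Bool → Set Z)
    (hVU : ∀ i, ∀ z ∈ U i, ∀ z' ∈ U i, z ≠ z' → ∃ k, z ∈ V i k true ∧ z' ∈ V i k false)
    (h : ∀ k : ι → κ, CountablyInjFamily f fun p : Bool × ι => V p.2 (k p.2) p.1) :
    CountablyInjFamily f U := by
  classical
  cases nonempty_fintype ι
  let := upgradeStandardBorel X
  choose D hD hcov hinj using h
  choose C hC hCB hsub using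
    fun i => CountablyInjOn.iUnion fun b => CountablyInjOn.iUnion fun k => hinj k (b, i)
  have hCm (i) : MeasurableSet (⋃₀ C i) := .sUnion (hC i) fun B hB => (hCB i B hB).1
  let W (i : ι) : Set Z := U i \ ⋃₀ C i
  have hW (i) : MeasurableSet (W i) := (hU i).diff (hCm i)
  let P (i : ι) : Set (Z × Z) := (W i ×ˢ W i) ∩ ({p | p.1 = p.2}ᶜ ∩ {p | f p.1 = f p.2})
  have hP (i) : MeasurableSet (P i) :=
    ((hW i).prod (hW i)).inter ((measurableSet_eq_fun measurable_fst measurable_snd).compl.inter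
      (measurableSet_eq_fun (hf.comp measurable_fst) (hf.comp measurable_snd)))
  have hA (i) : AnalyticSet ((fun p : Z × Z => f p.1) '' P i) :=
    (hP i).analyticSet_image (hf.comp measurable_fst)
  obtain ⟨B, hB, hAB, hdisj⟩ :=
    AnalyticSet.exists_measurableSet_superset_disjoint_biInter Finset.univ hA
      isClosed_univ.analyticSet (by
        refine disjoint_left.2 fun x _ hx => ?_
        simp only [Finset.mem_univ, iInter_true, mem_iInter] at hx
        choose p hp hpx using hx
        choose k hk hk' using fun i =>
          hVU i (p i).1 (hp i).1.1.1 (p i).2 (hp i).1.2.1 (hp i).2.1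
        obtain ⟨⟨b, i⟩, hbi⟩ := hcov k x
        have key (z : Z) (hz : z ∈ W i) (hzV : z ∈ V i (k i) b) (hzx : f z = x) : False :=
          hz.2 (hsub i (mem_iUnion₂.2 ⟨b, k, hzV, by rwa [mem_preimage, hzx]⟩))
        cases b
        · exact key (p i).2 (hp i).1.2 (hk' i) ((hp i).2.2.symm.trans (hpx i))
        · exact key (p i).1 (hp i).1.1 (hk i) (hpx i))
  refine ⟨fun i => (B i)ᶜ, fun i => (hB i).compl, fun x => ?_, fun i => ?_⟩
  · by_contra! hx
    exact disjoint_left.1 hdisj (mem_univ x) (by simpa using hx)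
  · have hinjW : InjOn f (W i ∩ f ⁻¹' (B i)ᶜ) := by
      intro z hz z' hz' hzz'
      by_contra hne
      exact hz.2 (hAB i ⟨(z, z'), ⟨⟨hz.1, hz'.1⟩, hne, hzz'⟩, rfl⟩)
    refine ((hinjW.countablyInjOn ((hW i).inter (hf (hB i).compl))).union
      ⟨C i, hC i, hCB i, Subset.rfl⟩).mono fun z hz => ?_
    by_cases hzC : z ∈ ⋃₀ C i
    · exact .inr hzC
    · exact .inl ⟨⟨hz.1, hzC⟩, hz.2⟩

end CountableToOne

section CantorScheme

variable {Z X : Type*} [MetricSpace Z] [MeasurableSpace Z] [BorelSpace Z]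
  [CompleteSpace Z] [SecondCountableTopology Z] [MeasurableSpace X] [StandardBorelSpace X]
  {f : Z → X}

theorem exists_isOpen_split_of_not_countablyInjFamily {ι : Type*} [Finite ι] (hf : Measurable f)
    {U : ι → Set Z} (hU : ∀ i, IsOpen (U i)) (h : ¬ CountablyInjFamily f U)
    {ε : ENNReal} (hε : 0 < ε) :
    ∃ V : Bool × ι → Set Z, (∀ p, IsOpen (V p)) ∧ (¬ CountablyInjFamily f V) ∧
      (∀ p, closure (V p) ⊆ U p.2 ∧ Metric.ediam (V p) ≤ ε) ∧
      ∀ i, Disjoint (V (true, i)) (V (false, i)) := by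
  classical
  let G (i : ι) (q : Bool → Set Z) : Prop :=
    (∀ b, closure (q b) ⊆ U i ∧ Metric.ediam (q b) ≤ ε) ∧ Disjoint (q true) (q false)
  let V (i : ι) (q : Bool → countableBasis Z) (b : Bool) : Set Z :=
    if G i fun b => q b then q b else ∅
  have hV (i q) : G i (V i q) := by
    by_cases hG : G i fun b => q b
    · simp only [V, hG, if_true]
    · simp only [V, hG, if_false]
      simp [G]
  have hbasis (i : ι) (z : Z) (hz : z ∈ U i) (O : Set Z) (hO : IsOpen O) (hzO : z ∈ O) :
      ∃ B ∈ countableBasis Z, z ∈ B ∧ B ⊆ O ∧ closure B ⊆ U i ∧ Metric.ediam B ≤ ε := by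
    obtain ⟨B, hB, hzB, hBs⟩ := (isBasis_countableBasis Z).exists_closure_subset
      (inter_mem ((hU i).mem_nhds hz) (inter_mem (hO.mem_nhds hzO)
        (Metric.eball_mem_nhds z (ENNReal.half_pos hε.ne'))))
    refine ⟨B, hB, hzB, fun y hy => (hBs (subset_closure hy)).2.1, fun y hy => (hBs hy).1, ?_⟩
    refine (Metric.ediam_mono fun y hy => (hBs (subset_closure hy)).2.2).trans
      (Metric.ediam_eball_le.trans_eq ?_)
    exact ENNReal.mul_div_cancel two_ne_zero ENNReal.ofNat_ne_top
  by_contra! hcon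
  refine h (countablyInjFamily_of_forall_split hf (fun i => (hU i).measurableSet) V ?_ ?_)
  · intro i z hz z' hz' hne
    obtain ⟨O, O', hO, hO', hzO, hzO', hOO'⟩ := t2_separation hne
    obtain ⟨B, hB, hzB, hBO, hBU⟩ := hbasis i z hz O hO hzO
    obtain ⟨B', hB', hzB', hBO', hBU'⟩ := hbasis i z' hz' O' hO' hzO'
    let q (b : Bool) : countableBasis Z := if b then ⟨B, hB⟩ else ⟨B', hB'⟩
    have hG : G i fun b => q b :=
      ⟨by rintro (_ | _) <;> assumption, hOO'.mono hBO hBO'⟩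
    refine ⟨q, ?_, ?_⟩ <;> simp only [V, hG, if_true] <;> assumption
  · intro k
    by_contra hk
    have hVo (p : Bool × ι) : IsOpen (V p.2 (k p.2) p.1) := by
      dsimp only [V]
      split_ifs
      · exact isOpen_of_mem_countableBasis (k p.2 p.1).2
      · exact isOpen_empty
    obtain ⟨i, hi⟩ := hcon _ hVo hk fun p => (hV p.2 (k p.2)).1 p.1
    exact hi (hV i (k i)).2

/-- If `f` is not countably injective, there is a Cantor scheme of open sets none of whose levels
is a countably injective family. -/
theorem exists_cantorScheme_of_not_countablyInjOn (hf : Measurable f)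
    (h : ¬ CountablyInjOn f univ) :
    ∃ A : List Bool → Set Z, CantorScheme.ClosureAntitone A ∧ CantorScheme.VanishingDiam A ∧
      CantorScheme.Disjoint A ∧
      ∀ n, ¬ CountablyInjFamily f fun l : {l : List Bool // l.length = n} => A l := by
  classical
  let Level (n : ℕ) : Type := {l : List Bool // l.length = n}
  have (n : ℕ) : Finite (Level n) := (List.finite_length_eq Bool n).to_subtype
  let Good (n : ℕ) : Type _ :=
    {U : Level n → Set Z // (∀ l, IsOpen (U l)) ∧ ¬ CountablyInjFamily f U}
  let ext (n : ℕ) (p : Bool × Level n) : Level (n + 1) := ⟨p.1 :: p.2.1, by simp [p.2.2]⟩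
  have step (n : ℕ) (U : Good n) : ∃ V : Good (n + 1),
      (∀ p, closure (V.1 (ext n p)) ⊆ U.1 p.2 ∧ Metric.ediam (V.1 (ext n p)) ≤ (n : ENNReal)⁻¹) ∧
      ∀ l, Disjoint (V.1 (ext n (true, l))) (V.1 (ext n (false, l))) := by
    obtain ⟨V, hVo, hV, hVU, hVd⟩ := exists_isOpen_split_of_not_countablyInjFamily hf U.2.1 U.2.2
      (ε := (n : ENNReal)⁻¹) (ENNReal.inv_pos.2 (ENNReal.natCast_ne_top n))
    let e : Bool × Level n ≃ Level (n + 1) := Equiv.ofBijective (ext n) <| by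
      constructor
      · rintro ⟨b, l, hl⟩ ⟨b', l', hl'⟩ hbl
        have := List.cons.inj (congrArg Subtype.val hbl)
        exact Prod.ext this.1 (Subtype.ext this.2)
      · rintro ⟨_ | ⟨b, l⟩, hl⟩
        · simp at hl
        · exact ⟨(b, ⟨l, by simpa using hl⟩), rfl⟩
    have he (p) : e.symm (ext n p) = p := e.symm_apply_apply p
    refine ⟨⟨V ∘ e.symm, fun l => hVo _, fun hcon => hV ?_⟩, ?_, ?_⟩
    · simpa [Function.comp_assoc] using hcon.comp_surjective e.surjective
    · simpa [he] using hVU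
    · simpa [he] using hVd
  have h0 : ¬ CountablyInjFamily f fun _ : Level 0 => (univ : Set Z) := by
    rintro ⟨D, -, hcov, hinj⟩
    refine h ((hinj ⟨[], rfl⟩).mono fun z _ => ⟨mem_univ z, ?_⟩)
    obtain ⟨⟨l, hl⟩, hz⟩ := hcov (f z)
    obtain rfl := List.eq_nil_of_length_eq_zero hl
    exact hz
  choose next hnext hdisj using step
  let S (n : ℕ) : Good n := Nat.rec ⟨fun _ => univ, fun _ => isOpen_univ, h0⟩ next n
  let A (l : List Bool) : Set Z := (S l.length).1 ⟨l, rfl⟩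
  refine ⟨A, fun l b => (hnext _ (S l.length) (b, ⟨l, rfl⟩)).1, fun x => ?_, fun l b b' hbb' => ?_,
    fun n => ?_⟩
  · rw [← tendsto_add_atTop_iff_nat 1]
    refine tendsto_of_tendsto_of_tendsto_of_le_of_le tendsto_const_nhds
      ENNReal.tendsto_inv_nat_nhds_zero (fun n => zero_le) fun n => ?_
    have := (hnext _ (S (PiNat.res x n).length) (x n, ⟨PiNat.res x n, rfl⟩)).2
    exact this.trans_eq (by rw [PiNat.res_length])
  · have hd := hdisj _ (S l.length) ⟨l, rfl⟩
    cases b <;> cases b'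
    · exact absurd rfl hbb'
    · exact hd.symm
    · exact hd
    · exact absurd rfl hbb'
  · have : (fun l : Level n => A l.1) = (S n).1 := by
      funext ⟨l, hl⟩
      subst hl
      rfl
    exact this ▸ (S n).2.2

theorem not_countable_nat_bool : ¬ (univ : Set (ℕ → Bool)).Countable := by
  rw [countable_univ_iff, ← Cardinal.mk_le_aleph0_iff]
  simp [Cardinal.aleph0_lt_continuum]

theorem countablyInjOn_univ_of_continuous [TopologicalSpace X] [T2Space X]
    [OpensMeasurableSpace X] (hf : Continuous f) (hm : Measurable f)
    (hc : ∀ x, (f ⁻¹' {x}).Countable) :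
    CountablyInjOn f univ := by
  by_contra h
  obtain ⟨A, hanti, hdiam, hdisj, hA⟩ := exists_cantorScheme_of_not_countablyInjOn hm h
  have hne (l : List Bool) : (A l).Nonempty := by
    rw [nonempty_iff_ne_empty]
    exact fun hl => hA l.length (countablyInjFamily_of_eq_empty (i := ⟨l, rfl⟩) hl)
  have htot := hanti.map_of_vanishingDiam hdiam hne
  let φ (x : ℕ → Bool) : Z := (CantorScheme.inducedMap A).2 ⟨x, htot ▸ mem_univ x⟩
  have hφ : φ.Injective := fun x y hxy => congrArg Subtype.val (hdisj.map_injective hxy)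
  have hmem (x n) : φ x ∈ A (PiNat.res x n) := CantorScheme.map_mem _ n
  have hsmall (x : ℕ → Bool) (O : Set Z) (hO : IsOpen O) (hxO : φ x ∈ O) :
      ∀ᶠ n in atTop, A (PiNat.res x n) ⊆ O := by
    obtain ⟨ε, hε, hball⟩ := EMetric.mem_nhds_iff.1 (hO.mem_nhds hxO)
    filter_upwards [(hdiam x).eventually_lt_const hε] with n hn z hz
    exact hball ((Metric.edist_le_ediam_of_mem hz (hmem x n)).trans_lt hn)
  have hconst (x y : ℕ → Bool) : f (φ x) = f (φ y) := by
    by_contra hne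
    obtain ⟨O, O', hO, hO', hxO, hyO', hOO'⟩ := t2_separation hne
    have hxy : ∀ᶠ n in atTop, PiNat.res x n ≠ PiNat.res y n := by
      have hxy : x ≠ y := by rintro rfl; exact hne rfl
      obtain ⟨m, hm⟩ := Function.ne_iff.1 hxy
      filter_upwards [eventually_gt_atTop m] with n hn hres
      exact hm (PiNat.res_eq_res.1 hres hn)
    obtain ⟨n, hn, hnx, hny⟩ := (hxy.and ((hsmall x _ (hO.preimage hf) hxO).and
      (hsmall y _ (hO'.preimage hf) hyO'))).exists
    refine hA n (countablyInjFamily_of_separated (i := ⟨_, PiNat.res_length x n⟩)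
      (j := ⟨_, PiNat.res_length y n⟩) (by simpa using hn) hO.measurableSet hnx ?_)
    exact fun z hz hzO => disjoint_left.1 hOO' hzO (hny hz)
  have hcount : (univ : Set (ℕ → Bool)).Countable := by
    refine MapsTo.countable_of_injOn (fun x _ => ?_) hφ.injOn (hc (f (φ fun _ => true)))
    exact hconst x _
  exact not_countable_nat_bool hcount

end CantorScheme

/-- **Lusin–Novikov theorem**: a countable-to-one measurable map between standard Borel spaces is
injective on each piece of some countable measurable cover. -/
theorem exists_measurableSet_injOn_cover {Z X : Type*} [MeasurableSpace Z] [StandardBorelSpace Z]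
    [MeasurableSpace X] [StandardBorelSpace X] {f : Z → X} (hf : Measurable f)
    (hc : ∀ x, (f ⁻¹' {x}).Countable) :
    ∃ B : ℕ → Set Z, (∀ n, MeasurableSet (B n) ∧ InjOn f (B n)) ∧ ⋃ n, B n = univ := by
  have h : CountablyInjOn f univ := by
    let := upgradeStandardBorel X
    let := upgradeStandardBorel Z
    obtain ⟨t, ht, hft, hpt⟩ := hf.exists_continuous
    have hb : @BorelSpace Z t _ := by
      refine @BorelSpace.mk Z t _ ?_
      rw [eq_borel_upgradeStandardBorel Z]
      exact (borel_eq_borel_of_le hpt (upgradeStandardBorel Z).toPolishSpace ht).symm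
    let := t
    let := upgradeIsCompletelyMetrizable Z
    exact countablyInjOn_univ_of_continuous hft hf hc
  obtain ⟨C, hC, hCB, hcov⟩ := h
  obtain ⟨B, hB⟩ := (hC.union (countable_singleton ∅)).exists_eq_range ⟨∅, by simp⟩
  have hBC (n) : B n ∈ C ∪ {∅} := hB ▸ mem_range_self n
  refine ⟨B, fun n => ?_, ?_⟩
  · obtain hn | hn := hBC n
    · exact hCB _ hn
    · rw [mem_singleton_iff.1 hn]
      exact ⟨.empty, injOn_empty f⟩
  · rw [← sUnion_range, ← hB]
    exact eq_univ_of_univ_subset (hcov.trans (sUnion_mono subset_union_left))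

section PartialInjections

variable {X : Type*} {G : Set (X × X)} {P Q : Set X}

/-- The involution exchanging the two coordinates of every point of `G`, for `G` the graph of a
bijection between two disjoint sets. -/
theorem exists_involutive_of_graph (hfst : InjOn Prod.fst G) (hsnd : InjOn Prod.snd G)
    (hG : G ⊆ P ×ˢ Q) (hPQ : Disjoint P Q) :
    ∃ g : X → X, Function.Involutive g ∧ (∀ p ∈ G, g p.1 = p.2 ∧ g p.2 = p.1) ∧
      ∀ x, x ∉ Prod.fst '' G → x ∉ Prod.snd '' G → g x = x := by
  classical
  let R (x y : X) : Prop := (x, y) ∈ G ∨ (y, x) ∈ G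
  have hR {x y z} (hxy : R x y) (hxz : R x z) : y = z := by
    obtain h | h := hxy <;> obtain h' | h' := hxz
    · exact congrArg Prod.snd (hfst h h' rfl)
    · exact (disjoint_left.1 hPQ (hG h).1 (hG h').2).elim
    · exact (disjoint_left.1 hPQ (hG h').1 (hG h).2).elim
    · exact congrArg Prod.fst (hsnd h h' rfl)
  let g (x : X) : X := if h : ∃ y, R x y then h.choose else x
  have hg {x y} (h : R x y) : g x = y := by
    have hex : ∃ y, R x y := ⟨y, h⟩
    simp only [g, hex, dite_true]
    exact hR hex.choose_spec h
  have hg' {x} (h : ¬ ∃ y, R x y) : g x = x := by simp only [g, h, dite_false]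
  refine ⟨g, fun x => ?_, fun p hp => ⟨hg (.inl hp), hg (.inr hp)⟩, fun x hx hx' => hg' ?_⟩
  · by_cases h : ∃ y, R x y
    · obtain ⟨y, hy⟩ := h
      rw [hg hy, hg hy.symm]
    · rw [hg' h, hg' h]
  · rintro ⟨y, h | h⟩
    · exact hx ⟨_, h, rfl⟩
    · exact hx' ⟨_, h, rfl⟩

variable [MeasurableSpace X] [StandardBorelSpace X]

theorem exists_measurable_involutive_of_graph (hGm : MeasurableSet G) (hfst : InjOn Prod.fst G)
    (hsnd : InjOn Prod.snd G) (hG : G ⊆ P ×ˢ Q) (hPQ : Disjoint P Q) :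
    ∃ g : X → X, Measurable g ∧ Function.Involutive g ∧ (∀ p ∈ G, g p.1 = p.2) ∧
      ∀ x, g x = x ∨ (x, g x) ∈ G ∨ (g x, x) ∈ G := by
  obtain ⟨g, hg, hgG, hid⟩ := exists_involutive_of_graph hfst hsnd hG hPQ
  have him₁ {C} (hC : MeasurableSet C) : MeasurableSet (Prod.fst '' (G ∩ C)) :=
    (hGm.inter hC).image_of_measurable_injOn measurable_fst (hfst.mono inter_subset_left)
  have him₂ {C} (hC : MeasurableSet C) : MeasurableSet (Prod.snd '' (G ∩ C)) :=
    (hGm.inter hC).image_of_measurable_injOn measurable_snd (hsnd.mono inter_subset_left)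
  refine ⟨g, fun C hC => ?_, hg, fun p hp => (hgG p hp).1, fun x => ?_⟩
  · have : g ⁻¹' C = (Prod.fst '' (G ∩ Prod.snd ⁻¹' C) ∪ Prod.snd '' (G ∩ Prod.fst ⁻¹' C)) ∪
        C \ (Prod.fst '' (G ∩ univ) ∪ Prod.snd '' (G ∩ univ)) := by
      ext x
      simp only [inter_univ]
      by_cases hx : x ∈ Prod.fst '' G
      · obtain ⟨p, hp, rfl⟩ := hx
        simp only [mem_preimage, (hgG p hp).1]
        constructor
        · exact fun h => .inl (.inl ⟨p, ⟨hp, h⟩, rfl⟩)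
        · rintro ((⟨q, ⟨hq, hqC⟩, hqp⟩ | ⟨q, ⟨hq, -⟩, hqp⟩) | h)
          · rwa [← hfst hq hp hqp]
          · exact (disjoint_left.1 hPQ (hG hp).1 (hqp ▸ (hG hq).2)).elim
          · exact (h.2 (.inl ⟨p, hp, rfl⟩)).elim
      by_cases hx' : x ∈ Prod.snd '' G
      · obtain ⟨p, hp, rfl⟩ := hx'
        simp only [mem_preimage, (hgG p hp).2]
        constructor
        · exact fun h => .inl (.inr ⟨p, ⟨hp, h⟩, rfl⟩)
        · rintro ((⟨q, ⟨hq, -⟩, hqp⟩ | ⟨q, ⟨hq, hqC⟩, hqp⟩) | h)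
          · exact (hx ⟨q, hq, hqp⟩).elim
          · rwa [← hsnd hq hp hqp]
          · exact (h.2 (.inr ⟨p, hp, rfl⟩)).elim
      · rw [mem_preimage, hid x hx hx']
        constructor
        · exact fun h => .inr ⟨h, fun h => h.elim hx hx'⟩
        · rintro ((⟨q, ⟨hq, -⟩, hqp⟩ | ⟨q, ⟨hq, -⟩, hqp⟩) | h)
          · exact (hx ⟨q, hq, hqp⟩).elim
          · exact (hx' ⟨q, hq, hqp⟩).elim
          · exact h.1
    rw [this]
    exact ((him₁ (measurable_snd hC)).union (him₂ (measurable_fst hC))).union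
      (hC.diff ((him₁ .univ).union (him₂ .univ)))
  · by_cases hx : x ∈ Prod.fst '' G
    · obtain ⟨p, hp, rfl⟩ := hx
      exact .inr (.inl ((hgG p hp).1.symm ▸ hp))
    by_cases hx' : x ∈ Prod.snd '' G
    · obtain ⟨p, hp, rfl⟩ := hx'
      exact .inr (.inr ((hgG p hp).2.symm ▸ hp))
    · exact .inl (hid x hx hx')

end PartialInjections

/-- A countable Borel equivalence relation is generated by countably many Borel involutions. -/
theorem exists_measurable_involutive_of_countable_classes {X : Type*} [MeasurableSpace X]
    [StandardBorelSpace X] {E : X → X → Prop} (hE : Equivalence E)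
    (hBorel : MeasurableSet {p : X × X | E p.1 p.2}) (hcount : ∀ x : X, {y : X | E x y}.Countable) :
    ∃ g : ℕ → X → X, (∀ n, Measurable (g n) ∧ Function.Involutive (g n) ∧ ∀ x, E x (g n x)) ∧
      ∀ x y, E x y → x = y ∨ ∃ n, g n x = y := by
  have := hBorel.standardBorel
  let Z := {p : X × X | E p.1 p.2}
  have hval : MeasurableEmbedding (Subtype.val : Z → X × X) := .subtype_coe hBorel
  obtain ⟨B, hB, hBcov⟩ := exists_measurableSet_injOn_cover
    (f := fun z : Z => z.1.1) (measurable_fst.comp measurable_subtype_coe) fun x => by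
      refine MapsTo.countable_of_injOn (f := fun z : Z => z.1.2) (t := {y | E x y}) ?_ ?_ (hcount x)
      · rintro z rfl
        exact z.2
      · rintro z hz z' hz' h
        exact Subtype.ext (Prod.ext (hz.trans hz'.symm) h)
  obtain ⟨B', hB', hBcov'⟩ := exists_measurableSet_injOn_cover
    (f := fun z : Z => z.1.2) (measurable_snd.comp measurable_subtype_coe) fun x => by
      refine MapsTo.countable_of_injOn (f := fun z : Z => z.1.1) (t := {y | E x y}) ?_ ?_ (hcount x)
      · rintro z rfl
        exact hE.symm z.2
      · rintro z hz z' hz' h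
        exact Subtype.ext (Prod.ext h (hz.trans hz'.symm))
  obtain ⟨c, hc, hcinj⟩ := MeasurableSpace.measurable_injection_nat_bool_of_countablySeparated X
  let P (k : ℕ) (b : Bool) : Set X := {x | c x k = b}
  have hP (k b) : MeasurableSet (P k b) :=
    measurableSet_eq_fun ((measurable_pi_apply k).comp hc) measurable_const
  let G (i : ℕ × ℕ × ℕ × Bool) : Set (X × X) :=
    Subtype.val '' (B i.1 ∩ B' i.2.1) ∩ P i.2.2.1 i.2.2.2 ×ˢ P i.2.2.1 !i.2.2.2
  have hGE {i p} (hp : p ∈ G i) : E p.1 p.2 := by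
    obtain ⟨⟨z, -, rfl⟩, -⟩ := hp
    exact z.2
  have hg (i) : ∃ g : X → X, Measurable g ∧ Function.Involutive g ∧ (∀ p ∈ G i, g p.1 = p.2) ∧
      ∀ x, g x = x ∨ (x, g x) ∈ G i ∨ (g x, x) ∈ G i := by
    refine exists_measurable_involutive_of_graph
      ((hval.measurableSet_image.2 ((hB _).1.inter (hB' _).1)).inter ((hP _ _).prod (hP _ _)))
      ?_ ?_ inter_subset_right ?_
    · rintro _ ⟨⟨z, hz, rfl⟩, -⟩ _ ⟨⟨z', hz', rfl⟩, -⟩ h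
      exact congrArg _ ((hB _).2 hz.1 hz'.1 h)
    · rintro _ ⟨⟨z, hz, rfl⟩, -⟩ _ ⟨⟨z', hz', rfl⟩, -⟩ h
      exact congrArg _ ((hB' _).2 hz.2 hz'.2 h)
    · refine disjoint_left.2 fun x (hx : c x _ = _) (hx' : c x _ = _) => ?_
      simp [hx] at hx'
  choose g hgm hgi hgG hgx using hg
  obtain ⟨e, he⟩ := exists_surjective_nat (ℕ × ℕ × ℕ × Bool)
  refine ⟨fun n => g (e n), fun n => ⟨hgm _, hgi _, fun x => ?_⟩, fun x y hxy => ?_⟩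
  · obtain h | h | h := hgx (e n) x
    · simpa only [h] using hE.refl x
    · exact hGE h
    · exact hE.symm (hGE h)
  · rw [or_iff_not_imp_left]
    intro hne
    obtain ⟨k, hk⟩ := Function.ne_iff.1 (hcinj.ne hne)
    let z : Z := ⟨(x, y), hxy⟩
    obtain ⟨m, hm⟩ := mem_iUnion.1 (hBcov.symm ▸ mem_univ z)
    obtain ⟨m', hm'⟩ := mem_iUnion.1 (hBcov'.symm ▸ mem_univ z)
    obtain ⟨n, hn⟩ := he (m, m', k, c x k)
    refine ⟨n, hgG (e n) (x, y) ?_⟩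
    rw [hn]
    exact ⟨⟨z, ⟨hm, hm'⟩, rfl⟩, rfl, Bool.eq_not_of_ne (Ne.symm hk)⟩

theorem measurable_freeGroup_lift {X ι : Type*} [MeasurableSpace X] {σ : ι → Equiv.Perm X}
    (hσ : ∀ i, Measurable (σ i)) (hσ' : ∀ i, Measurable ⇑(σ i)⁻¹) (γ : FreeGroup ι) :
    Measurable (FreeGroup.lift σ γ) := by
  induction γ using FreeGroup.induction_on with
  | C1 => simpa using measurable_id
  | of i => simpa using hσ i
  | inv_of i _ => simpa using hσ' i
  | mul γ δ hγ hδ => simpa using hγ.comp hδ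

theorem rel_freeGroup_lift {X ι : Type*} {E : X → X → Prop} (hE : Equivalence E)
    {σ : ι → Equiv.Perm X} (hσ : ∀ i x, E x (σ i x)) (γ : FreeGroup ι) (x : X) :
    E x (FreeGroup.lift σ γ x) := by
  induction γ using FreeGroup.induction_on generalizing x with
  | C1 => simpa using hE.refl x
  | of i => simpa using hσ i x
  | inv_of i _ => simpa using hE.symm (hσ i ((σ i)⁻¹ x))
  | mul γ δ hγ hδ => simpa using hE.trans (hδ x) (hγ _)

/-- **Feldman–Moore theorem, original form**: every countable Borel equivalence relation is
the orbit equivalence relation of a Borel action of the free group on countably many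
generators. -/
theorem stmt_4 {X : Type*} [MeasurableSpace X] [StandardBorelSpace X]
    (E : X → X → Prop) (hE : Equivalence E)
    (hBorel : MeasurableSet {p : X × X | E p.1 p.2})
    (hcount : ∀ x : X, {y : X | E x y}.Countable) :
    ∃ a : FreeGroup ℕ →* Equiv.Perm X,
      (∀ γ : FreeGroup ℕ, Measurable ⇑(a γ)) ∧
      ∀ x y : X, E x y ↔ ∃ γ : FreeGroup ℕ, a γ x = y := by
  obtain ⟨g, hg, hgE⟩ := exists_measurable_involutive_of_countable_classes hE hBorel hcount
  let σ (n : ℕ) : Equiv.Perm X := (hg n).2.1.toPerm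
  have hσ (n : ℕ) : (σ n)⁻¹ = σ n := (hg n).2.1.toPerm_symm
  refine ⟨FreeGroup.lift σ, measurable_freeGroup_lift (fun n => (hg n).1) fun n => ?_,
    fun x y => ⟨fun hxy => ?_, ?_⟩⟩
  · rw [hσ]
    exact (hg n).1
  · obtain rfl | ⟨n, hn⟩ := hgE x y hxy
    · exact ⟨1, by simp⟩
    · exact ⟨FreeGroup.of n, by rwa [FreeGroup.lift_apply_of]⟩
  · rintro ⟨γ, rfl⟩
    exact rel_freeGroup_lift hE (fun n => (hg n).2.2) γ x
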